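/- Let α : A → B be a locally compact de Vries extension and define a ◁ b iff (a ∧ c) ≺ (b ∨ ¬c) for all c ∈ I_α. If a ≺ b then a ◁ b; if a ◁ b then ¬α(¬a) ≤ α(b); and if a ∈ I_α and a ◁ b then a ≺ b. -/

import Mathlib

/-- `a` is α-compact. -/
def IsAlphaCompact {A B : Type*} [CompleteBooleanAlgebra A] [CompleteBooleanAlgebra B]
    (α : A → B) (a : A) : Prop :=
  ∀ S : Set A, (α aᶜ)ᶜ ≤ sSup (α '' S) →
    ∃ T ⊆ S, T.Finite ∧ (α aᶜ)ᶜ ≤ sSup (α '' T)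

theorem stmt13 {A B : Type*} [CompleteBooleanAlgebra A] [CompleteBooleanAlgebra B]
    [IsAtomic B] (prec : A → A → Prop) (α : A → B)
    (dv1 : prec ⊤ ⊤)
    (dv2 : ∀ a b : A, prec a b → a ≤ b)
    (dv3 : ∀ a b c d : A, a ≤ b → prec b c → c ≤ d → prec a d)
    (dv4 : ∀ a b c : A, prec a b → prec a c → prec a (b ⊓ c))
    (dv5 : ∀ a b : A, prec a b → prec bᶜ aᶜ)
    (dv6 : ∀ a b : A, prec a b → ∃ c, prec a c ∧ prec c b)
    (dv7 : ∀ b : A, b = sSup {a : A | prec a b})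
    (hinj : Function.Injective α)
    (m1 : α ⊥ = ⊥)
    (m2 : ∀ a b : A, α (a ⊓ b) = α a ⊓ α b)
    (m3 : ∀ a b : A, prec a b → (α aᶜ)ᶜ ≤ α b)
    (m4 : ∀ b : A, α b = sSup (α '' {a : A | prec a b}))
    (hdense : ∀ y : B, ∃ T : Set (Set A), y = sSup ((fun S => sInf (α '' S)) '' T))
    (hlc : ∀ b : A, α b = sSup (α '' {a : A | IsAlphaCompact α a ∧ prec a b}))
    (lhd : A → A → Prop)
    (hlhd : ∀ a b : A, lhd a b ↔ ∀ c : A, IsAlphaCompact α c → prec (a ⊓ c) (b ⊔ cᶜ)) :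
    (∀ a b : A, prec a b → lhd a b) ∧
    (∀ a b : A, lhd a b → (α aᶜ)ᶜ ≤ α b) ∧
    (∀ a b : A, IsAlphaCompact α a → lhd a b → prec a b) := by
  have mono : ∀ a b : A, a ≤ b → α a ≤ α b := by
    intro a b h
    have h2 := m2 a b
    rw [inf_eq_left.mpr h] at h2
    exact inf_eq_left.mp h2.symm
  have refl : ∀ a b : A, α a ≤ α b → a ≤ b := by
    intro a b h
    apply inf_eq_left.mp
    apply hinj
    rw [m2, inf_eq_left.mpr h]
  have htop : α ⊤ = ⊤ := by
    have h := m3 ⊤ ⊤ dv1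
    rw [compl_top, m1, compl_bot] at h
    exact top_le_iff.mp h
  have hbot : ∀ b : A, prec ⊥ b := by
    intro b
    have h := dv5 _ _ dv1
    rw [compl_top] at h
    exact dv3 _ _ _ _ le_rfl h bot_le
  have hsup : ∀ a b c : A, prec a c → prec b c → prec (a ⊔ b) c := by
    intro a b c h1 h2
    have h := dv5 _ _ (dv4 _ _ _ (dv5 _ _ h1) (dv5 _ _ h2))
    simpa [compl_inf] using h
  have p2 : ∀ a b : A, lhd a b → (α aᶜ)ᶜ ≤ α b := by
    intro a b h
    rw [hlhd] at h
    have e : (α aᶜ)ᶜ = (α aᶜ)ᶜ ⊓ sSup (α '' {c : A | IsAlphaCompact α c ∧ prec c ⊤}) := by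
      rw [← hlc, htop, inf_top_eq]
    rw [e, inf_sSup_eq]
    refine iSup₂_le ?_
    rintro _ ⟨c, ⟨hc, -⟩, rfl⟩
    have h1 := m3 _ _ (h c hc)
    have h2 : α (a ⊓ c)ᶜ ⊓ α c ≤ α aᶜ := by
      rw [← m2]
      apply mono
      rw [compl_inf, inf_sup_right, compl_inf_self, sup_bot_eq]
      exact inf_le_left
    have h3 : α (b ⊔ cᶜ) ⊓ α c ≤ α b := by
      rw [← m2]
      apply mono
      rw [inf_sup_right, compl_inf_self, sup_bot_eq]
      exact inf_le_left
    have h4 : (α aᶜ)ᶜ ⊓ α c ≤ (α (a ⊓ c)ᶜ)ᶜ := by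
      rw [le_compl_iff_disjoint_right, disjoint_iff_inf_le]
      calc (α aᶜ)ᶜ ⊓ α c ⊓ α (a ⊓ c)ᶜ = (α aᶜ)ᶜ ⊓ (α (a ⊓ c)ᶜ ⊓ α c) := by
            rw [inf_assoc, inf_comm (α c)]
        _ ≤ (α aᶜ)ᶜ ⊓ α aᶜ := inf_le_inf_left _ h2
        _ ≤ ⊥ := by rw [compl_inf_self]
    exact (le_inf (h4.trans h1) inf_le_right).trans h3
  refine ⟨?_, p2, ?_⟩
  · intro a b h
    rw [hlhd]
    intro c _
    exact dv3 _ _ _ _ inf_le_left h le_sup_left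
  · intro a b ha h
    have h1 := p2 a b h
    rw [m4 b] at h1
    obtain ⟨T, hT, hf, hle⟩ := ha _ h1
    have key : prec (sSup T) b := by
      clear hle
      induction T, hf using Set.Finite.induction_on with
      | empty => simpa using hbot b
      | insert _ _ ih =>
        rw [sSup_insert]
        exact hsup _ _ _ (hT (Set.mem_insert _ _))
          (ih ((Set.subset_insert _ _).trans hT))
    refine dv3 _ _ _ _ (refl _ _ ?_) key le_rfl
    have h5 : α a ≤ (α aᶜ)ᶜ := by
      rw [le_compl_iff_disjoint_right, disjoint_iff_inf_le, ← m2, inf_compl_self, m1]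
    refine h5.trans (hle.trans (sSup_le ?_))
    rintro _ ⟨d, hd, rfl⟩
    exact mono _ _ (le_sSup hd)
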